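/- Let $1 < p < 2 < q$ with $p' \neq q$, set $\beta/2 = 1/p - 1/q - 1/2$ and assume $\beta < 0$. Let $\phi = \max\{p', q\}$ and $\lambda$ be defined by $\frac{1}{\phi}(1 - \frac{\lambda}{2}) = -\frac{\beta}{2}$. If $C_b : L^p(\mathbb{C}) \to L^q(\mathbb{C})$ is bounded, then $b$ belongs to the Campanato space $\mathscr{L}^{\phi,\lambda}(\mathbb{C})$, i.e. $\sup_Q \big(|Q|^{-\lambda/2} \int_Q |b - b_Q|^\phi\big)^{1/\phi} < \infty$, where the supremum is over all squares $Q$. -/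

import Mathlib

open MeasureTheory ENNReal

noncomputable section

/-- The commutator of the Cauchy transform. -/
def cauchyComm (b f : ℂ → ℂ) (z : ℂ) : ℂ :=
  ∫ w, (b z - b w) / (z - w) * f w

/-- The half-open axis-parallel square in `ℂ` with lower-left corner `c`, side `ℓ`. -/
def square (c : ℂ) (ℓ : ℝ) : Set ℂ :=
  {z | (c.re ≤ z.re ∧ z.re < c.re + ℓ) ∧ (c.im ≤ z.im ∧ z.im < c.im + ℓ)}

/-- The average `b_Q = ⨍_Q b`. -/
def sqAvg (b : ℂ → ℂ) (Q : Set ℂ) : ℂ :=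
  (volume Q).toReal⁻¹ • ∫ z in Q, b z

theorem square_eq_reProdIm (c : ℂ) (ℓ : ℝ) :
    square c ℓ = Set.Ico c.re (c.re + ℓ) ×ℂ Set.Ico c.im (c.im + ℓ) := by
  ext z
  simp [square, Complex.mem_reProdIm]

theorem measurableSet_square (c : ℂ) (ℓ : ℝ) : MeasurableSet (square c ℓ) := by
  rw [square_eq_reProdIm]
  exact (Complex.measurable_re measurableSet_Ico).inter (Complex.measurable_im measurableSet_Ico)

theorem volume_square (c : ℂ) {ℓ : ℝ} (hℓ : 0 < ℓ) :
    volume (square c ℓ) = ENNReal.ofReal (ℓ ^ 2) := by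
  have h : square c ℓ = Complex.measurableEquivRealProd ⁻¹'
      (Set.Ico c.re (c.re + ℓ) ×ˢ Set.Ico c.im (c.im + ℓ)) := by
    ext z
    simp [square, Complex.measurableEquivRealProd_apply]
  rw [h, Complex.volume_preserving_equiv_real_prod.measure_preimage
    (measurableSet_Ico.prod measurableSet_Ico).nullMeasurableSet, Measure.volume_eq_prod,
    Measure.prod_prod, Real.volume_Ico, Real.volume_Ico, ← ENNReal.ofReal_mul (by linarith)]
  congr 1
  ring

theorem norm_sub_le_of_mem_square {c z : ℂ} {ℓ : ℝ} (hz : z ∈ square c ℓ) : ‖z - c‖ ≤ 2 * ℓ := by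
  obtain ⟨⟨h1, h2⟩, h3, h4⟩ := hz
  refine (Complex.norm_le_abs_re_add_abs_im _).trans ?_
  rw [Complex.sub_re, Complex.sub_im, abs_of_nonneg (by linarith), abs_of_nonneg (by linarith)]
  linarith

theorem integrableOn_square {b : ℂ → ℂ} (hb : LocallyIntegrable b volume)
    (c : ℂ) (ℓ : ℝ) : IntegrableOn b (square c ℓ) volume :=
  (hb.integrableOn_isCompact (isCompact_closedBall c (2 * ℓ))).mono_set fun z hz => by
    simpa [dist_eq_norm] using norm_sub_le_of_mem_square hz

theorem integrable_indicator_ball_inv (R : ℝ) :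
    Integrable ((Metric.ball (0 : ℂ) R).indicator fun z => z⁻¹) volume := by
  have h : Integrable (fun z : ℂ => (Set.Iio R).indicator (fun r : ℝ => r⁻¹) ‖z‖) volume := by
    rw [integrable_fun_norm_addHaar volume (f := (Set.Iio R).indicator fun r : ℝ => r⁻¹)]
    have h1 : IntegrableOn (fun _ : ℝ => (1 : ℝ)) (Set.Ioo 0 R) volume := by simp
    have h2 : Integrable ((Set.Ioo 0 R).indicator fun _ : ℝ => (1 : ℝ)) volume :=
      h1.integrable_indicator measurableSet_Ioo
    refine (h2.integrableOn (s := Set.Ioi 0)).congr_fun (fun r hr => ?_) measurableSet_Ioi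
    have hr' : 0 < r := hr
    by_cases hR : r < R <;> simp [Set.indicator, hR, hr', hr'.ne', Complex.finrank_real_complex]
  refine h.mono' ?_ (Filter.Eventually.of_forall fun z => ?_)
  · exact (measurable_inv.indicator measurableSet_ball).aestronglyMeasurable
  · by_cases hz : ‖z‖ < R <;> simp [Set.indicator, hz]

/-- An integrable function supported in a square can be integrated against the Cauchy kernel at
almost every point of the square. -/
theorem ae_integrable_div_sub {f : ℂ → ℂ} (hf : Integrable f volume) {c : ℂ} {ℓ : ℝ}
    (hfQ : ∀ z ∉ square c ℓ, f z = 0) :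
    ∀ᵐ z, z ∈ square c ℓ → Integrable (fun w => f w / (z - w)) volume := by
  filter_upwards [hf.ae_convolution_exists (ContinuousLinearMap.mul ℝ ℂ)
    (integrable_indicator_ball_inv (4 * ℓ + 1))] with z hz hzQ
  refine Integrable.congr hz (Filter.Eventually.of_forall fun w => ?_)
  by_cases hw : w ∈ square c ℓ
  · have hzw : ‖z - w‖ < 4 * ℓ + 1 := by
      have h1 := norm_sub_le_of_mem_square hzQ
      have h2 := norm_sub_le_of_mem_square hw
      have h3 := norm_sub_le (z - c) (w - c)
      rw [sub_sub_sub_cancel_right] at h3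
      linarith
    simp [Set.indicator, hzw, div_eq_mul_inv]
  · simp [hfQ w hw]

theorem aestronglyMeasurable_cauchyComm {b f : ℂ → ℂ} (hb : AEStronglyMeasurable b volume)
    (hf : AEStronglyMeasurable f volume) : AEStronglyMeasurable (cauchyComm b f) volume := by
  have h : AEStronglyMeasurable
      (fun x : ℂ × ℂ => (b x.1 - b x.2) / (x.1 - x.2) * f x.2) (volume.prod volume) :=
    ((hb.comp_fst.sub hb.comp_snd).div₀
      (measurable_fst.sub measurable_snd).aestronglyMeasurable).mul hf.comp_snd
  exact h.integral_prod_right'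

theorem integrable_of_bounded_of_square {g : ℂ → ℂ} (hg : AEStronglyMeasurable g volume) {B : ℝ}
    (hB : ∀ z, ‖g z‖ ≤ B) {c : ℂ} {ℓ : ℝ} (hgQ : ∀ z ∉ square c ℓ, g z = 0)
    {b : ℂ → ℂ} (hb : IntegrableOn b (square c ℓ) volume) :
    Integrable (fun z => b z * g z) volume := by
  have h : Integrable ((square c ℓ).indicator b) volume :=
    hb.integrable_indicator (measurableSet_square c ℓ)
  refine (h.mul_bdd (c := B) hg (Filter.Eventually.of_forall hB)).congr
    (Filter.Eventually.of_forall fun z => ?_)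
  by_cases hz : z ∈ square c ℓ <;> simp [hz, hgQ]

/-- On a square containing the support of `g`, the difference `C_b ((· - c) g) - (· - c) C_b g`
no longer involves the Cauchy kernel. -/
theorem cauchyComm_mul_sub_mul_cauchyComm {b : ℂ → ℂ} (hb : LocallyIntegrable b volume)
    {g : ℂ → ℂ} (hg : AEStronglyMeasurable g volume) {B : ℝ} (hB : ∀ z, ‖g z‖ ≤ B)
    {c : ℂ} {ℓ : ℝ} (hℓ : 0 < ℓ) (hgQ : ∀ z ∉ square c ℓ, g z = 0) :
    ∀ᵐ z, z ∈ square c ℓ →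
      (∫ w, b w * g w) - b z * ∫ w, g w =
        cauchyComm b (fun w => (w - c) * g w) z - (z - c) * cauchyComm b g z := by
  have hbg := integrable_of_bounded_of_square hg hB hgQ (integrableOn_square hb c ℓ)
  have hgi : Integrable g volume := by
    have h1 : IntegrableOn (fun _ : ℂ => (1 : ℂ)) (square c ℓ) volume := by
      simp [integrableOn_const_iff, volume_square c hℓ]
    simpa using integrable_of_bounded_of_square hg hB hgQ h1
  filter_upwards [ae_integrable_div_sub hbg fun z hz => by simp [hgQ z hz],
    ae_integrable_div_sub hgi hgQ] with z h1 h2 hz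
  have hint : Integrable (fun w => (b z - b w) / (z - w) * g w) volume := by
    refine (((h2 hz).const_mul (b z)).sub (h1 hz)).congr (Filter.Eventually.of_forall fun w => ?_)
    simp only [Pi.sub_apply]
    ring
  have hdiff : ∀ w, (b z - b w) / (z - w) * ((w - c) * g w) =
      (z - c) * ((b z - b w) / (z - w) * g w) + (b w * g w - b z * g w) := by
    intro w
    rcases eq_or_ne z w with rfl | hzw
    · simp
    · have : z - w ≠ 0 := sub_ne_zero.2 hzw
      field_simp
      ring
  have hsub : Integrable (fun w => b w * g w - b z * g w) volume := hbg.sub (hgi.const_mul _)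
  unfold cauchyComm
  simp_rw [hdiff]
  rw [integral_add (hint.const_mul _) hsub, integral_const_mul, add_sub_cancel_left,
    integral_sub hbg (hgi.const_mul _), integral_const_mul]

theorem eLpNorm_const_sub_mul_le {p q K : ℝ} (hq : 1 ≤ q) (hK : 0 ≤ K) {b : ℂ → ℂ}
    (hb : LocallyIntegrable b volume)
    (hbound : ∀ f : ℂ → ℂ,
      eLpNorm (cauchyComm b f) (ENNReal.ofReal q) volume ≤
        ENNReal.ofReal K * eLpNorm f (ENNReal.ofReal p) volume)
    {g : ℂ → ℂ} (hg : AEStronglyMeasurable g volume) {B : ℝ} (hB : ∀ z, ‖g z‖ ≤ B)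
    {c : ℂ} {ℓ : ℝ} (hℓ : 0 < ℓ) (hgQ : ∀ z ∉ square c ℓ, g z = 0) :
    eLpNorm (fun z => (∫ w, b w * g w) - b z * ∫ w, g w) (ENNReal.ofReal q)
        (volume.restrict (square c ℓ)) ≤
      ENNReal.ofReal (4 * K * ℓ) * eLpNorm g (ENNReal.ofReal p) volume := by
  have hQ := measurableSet_square c ℓ
  set q' := ENNReal.ofReal q
  set p' := ENNReal.ofReal p
  set μ := volume.restrict (square c ℓ)
  have hsub : AEStronglyMeasurable (fun z : ℂ => z - c) volume := by fun_prop
  have hm1 : AEStronglyMeasurable (cauchyComm b fun w => (w - c) * g w) μ :=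
    (aestronglyMeasurable_cauchyComm hb.aestronglyMeasurable (hsub.mul hg)).restrict
  have hm2 : AEStronglyMeasurable (fun z => (z - c) * cauchyComm b g z) μ :=
    (hsub.mul (aestronglyMeasurable_cauchyComm hb.aestronglyMeasurable hg)).restrict
  have hfst : eLpNorm (cauchyComm b fun w => (w - c) * g w) q' μ ≤
      ENNReal.ofReal K * (ENNReal.ofReal (2 * ℓ) * eLpNorm g p' volume) := by
    refine (eLpNorm_mono_measure _ Measure.restrict_le_self).trans ((hbound _).trans ?_)
    gcongr
    refine eLpNorm_le_mul_eLpNorm_of_ae_le_mul (Filter.Eventually.of_forall fun z => ?_) _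
    by_cases hz : z ∈ square c ℓ
    · rw [norm_mul]
      gcongr
      exact norm_sub_le_of_mem_square hz
    · simp [hgQ z hz]
  have hsnd : eLpNorm (fun z => (z - c) * cauchyComm b g z) q' μ ≤
      ENNReal.ofReal (2 * ℓ) * (ENNReal.ofReal K * eLpNorm g p' volume) := by
    refine (eLpNorm_le_mul_eLpNorm_of_ae_le_mul (g := cauchyComm b g) (c := 2 * ℓ) ?_ _).trans ?_
    · filter_upwards [ae_restrict_mem hQ] with z hz
      rw [norm_mul]
      gcongr
      exact norm_sub_le_of_mem_square hz
    · gcongr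
      exact (eLpNorm_mono_measure _ Measure.restrict_le_self).trans (hbound _)
  calc _ = eLpNorm ((cauchyComm b fun w => (w - c) * g w) -
        fun z => (z - c) * cauchyComm b g z) q' μ := by
        refine eLpNorm_congr_ae ?_
        filter_upwards [ae_restrict_mem hQ, ae_restrict_of_ae
          (cauchyComm_mul_sub_mul_cauchyComm hb hg hB hℓ hgQ)] with z hz h
        exact h hz
    _ ≤ _ := eLpNorm_sub_le hm1 hm2 (by simpa [q'] using hq)
    _ ≤ _ := add_le_add hfst hsnd
    _ = _ := by
        rw [show 4 * K * ℓ = 2 * (K * (2 * ℓ)) by ring,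
          ENNReal.ofReal_mul (p := 2) (q := K * (2 * ℓ)) (by norm_num), ENNReal.ofReal_mul hK,
          ENNReal.ofReal_ofNat]
        ring

/-- If `∫ h g` over `Q` is controlled by the `L^p` norm of `g` for all bounded `g` supported in
`Q`, then `h` is in `L^{p'}(Q)` for the conjugate exponent `p'`. -/
theorem lintegral_rpow_le_of_forall_integral_mul_le {α : Type*} [MeasurableSpace α]
    {μ : Measure α} {p p' : ℝ} (hpp : p.HolderConjugate p') (hp' : 2 < p') {h : α → ℂ}
    (hh : AEStronglyMeasurable h μ) {Q : Set α} (hQ : MeasurableSet Q) (hQfin : μ Q ≠ ⊤)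
    {C : ℝ≥0∞}
    (H : ∀ (g : α → ℂ) (B : ℝ), AEStronglyMeasurable g μ → (∀ z, ‖g z‖ ≤ B) →
      (∀ z ∉ Q, g z = 0) → ‖∫ z, h z * g z ∂μ‖ₑ ≤ C * eLpNorm g (ENNReal.ofReal p) μ) :
    (∫⁻ z in Q, ‖h z‖ₑ ^ p' ∂μ) ^ (1 / p') ≤ C := by
  have hp0 : 0 < p := hpp.pos
  have hp'0 : 0 < p' := hpp.symm.pos
  let S : ℕ → Set α := fun n => Q ∩ {z | ‖h z‖ ≤ n}
  have hS_mono : Monotone S := fun m n hmn z hz =>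
    ⟨hz.1, le_trans (b := (m : ℝ)) hz.2 (Nat.cast_le.2 hmn)⟩
  have hS_union : ⋃ n, S n = Q := by
    ext z
    simp only [S, Set.mem_iUnion, Set.mem_inter_iff, Set.mem_ofPred_eq, exists_and_left,
      and_iff_left_iff_imp]
    exact fun _ => exists_nat_ge _
  have hS_meas : ∀ n, NullMeasurableSet (S n) μ := fun n =>
    hQ.nullMeasurableSet.inter (nullMeasurableSet_le hh.norm.aemeasurable aemeasurable_const)
  have hS_fin : ∀ n, μ (S n) ≠ ⊤ := fun n => measure_ne_top_of_subset Set.inter_subset_left hQfin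
  have key : ∀ n, ∫⁻ z in S n, ‖h z‖ₑ ^ p' ∂μ ≤ C ^ p' := by
    intro n
    let g : α → ℂ := (S n).indicator fun z => ((‖h z‖ ^ (p' - 2) : ℝ) : ℂ) * star (h z)
    have hg : AEStronglyMeasurable g μ := by
      refine AEStronglyMeasurable.indicator₀ ?_ (hS_meas n)
      refine AEStronglyMeasurable.mul ?_ hh.star
      exact (Complex.continuous_ofReal.measurable.comp_aemeasurable
        (hh.norm.aemeasurable.pow_const _)).aestronglyMeasurable
    have hg_norm : ∀ z ∈ S n, ‖g z‖ = ‖h z‖ ^ (p' - 1) := by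
      intro z hz
      rw [show g z = ((‖h z‖ ^ (p' - 2) : ℝ) : ℂ) * star (h z) from Set.indicator_of_mem hz _,
        norm_mul, norm_star, Complex.norm_real, Real.norm_of_nonneg (by positivity)]
      rw [← Real.rpow_add_one' (by positivity) (by linarith)]
      ring_nf
    have hg_zero : ∀ z ∉ S n, g z = 0 := fun z hz => Set.indicator_of_notMem hz _
    have hg_bdd : ∀ z, ‖g z‖ ≤ (n : ℝ) ^ (p' - 1) := by
      intro z
      by_cases hz : z ∈ S n
      · rw [hg_norm z hz]
        exact Real.rpow_le_rpow (norm_nonneg _) hz.2 (by linarith)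
      · rw [hg_zero z hz, norm_zero]
        positivity
    have hbd := H g _ hg hg_bdd fun z hz => hg_zero z fun h' => hz h'.1
    set A := ∫⁻ z in S n, ‖h z‖ₑ ^ p' ∂μ with hA
    have hA_fin : A ≠ ⊤ := by
      refine ne_top_of_le_ne_top (b := ∫⁻ _ in S n, ENNReal.ofReal n ^ p' ∂μ) ?_ ?_
      · rw [setLIntegral_const]
        exact ENNReal.mul_ne_top (by simp [hp'0.le]) (hS_fin n)
      · refine lintegral_mono_ae ?_
        filter_upwards [ae_restrict_mem₀ (hS_meas n)] with z hz
        rw [← ofReal_norm]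
        gcongr
        exact hz.2
    have henorm : ∀ z, ‖h z‖ₑ ^ p' = ENNReal.ofReal (‖h z‖ ^ p') := fun z => by
      rw [← ofReal_norm, ENNReal.ofReal_rpow_of_nonneg (norm_nonneg _) hp'0.le]
    have hint : ‖∫ z, h z * g z ∂μ‖ₑ = A := by
      have h1 : (fun z => h z * g z) =
          (S n).indicator fun z => ((‖h z‖ ^ p' : ℝ) : ℂ) := by
        ext z
        by_cases hz : z ∈ S n
        · simp only [g, Set.indicator_of_mem hz]
          rw [mul_left_comm, Complex.star_def, Complex.mul_conj', ← Complex.ofReal_pow,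
            ← Complex.ofReal_mul, ← Real.rpow_natCast, ← Real.rpow_add' (norm_nonneg _)
            (by push_cast; linarith)]
          push_cast
          ring_nf
        · simp [g, hz]
      have hi : Integrable (fun z => ‖h z‖ ^ p') (μ.restrict (S n)) := by
        refine ⟨(hh.norm.aemeasurable.pow_const _).aestronglyMeasurable.restrict, ?_⟩
        rw [hasFiniteIntegral_iff_ofReal (Filter.Eventually.of_forall fun z => by positivity)]
        simp_rw [← henorm]
        exact hA_fin.lt_top
      rw [h1, integral_indicator₀ (hS_meas n), integral_complex_ofReal, ← ofReal_norm,
        Complex.norm_real, Real.norm_of_nonneg (by positivity),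
        ofReal_integral_eq_lintegral_ofReal hi (Filter.Eventually.of_forall fun z => by positivity)]
      simp_rw [← henorm, hA]
    have hnorm : eLpNorm g (ENNReal.ofReal p) μ = A ^ (1 / p) := by
      rw [eLpNorm_eq_lintegral_rpow_enorm_toReal (by simpa using hp0) ENNReal.ofReal_ne_top,
        ENNReal.toReal_ofReal hp0.le, hA, ← lintegral_indicator₀ (hS_meas n)]
      congr 2
      ext z
      by_cases hz : z ∈ S n
      · rw [Set.indicator_of_mem hz, ← ofReal_norm, hg_norm z hz, henorm,
          ENNReal.ofReal_rpow_of_nonneg (by positivity) hp0.le, ← Real.rpow_mul (norm_nonneg _)]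
        rw [mul_comm, mul_sub, mul_one, hpp.mul_eq_add, add_sub_cancel_left]
      · rw [Set.indicator_of_notMem hz, hg_zero z hz]
        simp [hp0]
    rw [hint, hnorm] at hbd
    rcases eq_or_ne A 0 with h0 | h0
    · simp [h0]
    · have hsplit : A = A ^ (1 / p') * A ^ (1 / p) := by
        rw [← ENNReal.rpow_add _ _ h0 hA_fin, one_div, one_div, add_comm, hpp.inv_add_inv_eq_one,
          ENNReal.rpow_one]
      have hle : A ^ (1 / p') ≤ C := by
        have hne0 : A ^ (1 / p) ≠ 0 := by simp [h0, hA_fin]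
        have hnet : A ^ (1 / p) ≠ ⊤ := ENNReal.rpow_ne_top_of_nonneg (by positivity) hA_fin
        rw [← ENNReal.mul_le_mul_iff_left hne0 hnet, ← hsplit]
        exact hbd
      rw [one_div] at hle
      exact (ENNReal.rpow_inv_le_iff hp'0).1 hle
  rw [one_div, ENNReal.rpow_inv_le_iff hp'0, ← hS_union,
    setLIntegral_iUnion_of_directed _ hS_mono.directed_le]
  exact iSup_le key

theorem rpow_mul_rpow_le_of_le {φ lam γ ℓ K : ℝ} (hφ : 0 < φ) (hK : 0 ≤ K) (hℓ : 0 < ℓ)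
    {V X : ℝ≥0∞} (hV : V = ENNReal.ofReal (ℓ ^ 2))
    (hγ : 2 * γ + 1 = lam / φ)
    (hX : V * X ^ (1 / φ) ≤ ENNReal.ofReal (4 * K * ℓ) * V ^ (1 + γ)) :
    (V ^ (-lam / 2 : ℝ) * X) ^ (1 / φ) ≤ ENNReal.ofReal (4 * K) := by
  have hV0 : V ≠ 0 := by rw [hV]; simp [hℓ.ne']
  have hVt : V ≠ ⊤ := by rw [hV]; exact ENNReal.ofReal_ne_top
  have hℓV : ENNReal.ofReal ℓ = V ^ (1 / 2 : ℝ) := by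
    rw [hV, ENNReal.ofReal_rpow_of_nonneg (by positivity) (by norm_num), ← Real.sqrt_eq_rpow,
      Real.sqrt_sq hℓ.le]
  rw [ENNReal.ofReal_mul (by positivity), hℓV, mul_assoc, ← ENNReal.rpow_add _ _ hV0 hVt] at hX
  rw [ENNReal.mul_rpow_of_nonneg _ _ (by positivity), ← ENNReal.rpow_mul]
  have hsplit : V ^ (-lam / 2 * (1 / φ)) = V ^ (-(1 / 2 + (1 + γ))) * V := by
    nth_rewrite 3 [← ENNReal.rpow_one V]
    rw [← ENNReal.rpow_add _ _ hV0 hVt]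
    congr 1
    have : lam / φ = lam * (1 / φ) := by ring
    linarith
  rw [hsplit, mul_assoc]
  calc _ ≤ V ^ (-(1 / 2 + (1 + γ))) * (ENNReal.ofReal (4 * K) * V ^ (1 / 2 + (1 + γ))) := by gcongr
    _ = ENNReal.ofReal (4 * K) := by
      rw [mul_left_comm, ← ENNReal.rpow_add _ _ hV0 hVt, neg_add_cancel, ENNReal.rpow_zero, mul_one]

/-- **Necessity, `β < 0` case.** If `1 < p < 2 < q`, `p' ≠ q`,
`β/2 = 1/p - 1/q - 1/2 < 0`, `φ = max{p', q}` and `(1/φ)(1 - λ/2) = -β/2`, and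
`C_b : L^p(ℂ) → L^q(ℂ)` is bounded, then `b` lies in the Campanato space
`𝓛^{φ,λ}(ℂ)`: `sup_Q (|Q|^{-λ/2} ∫_Q |b - b_Q|^φ)^{1/φ} < ∞`. -/
theorem campanato_of_bounded_comm (p q β phi lam K : ℝ)
    (hp : 1 < p) (hp2 : p < 2) (hq : 2 < q) (hne : p / (p - 1) ≠ q)
    (hβ : β / 2 = 1 / p - 1 / q - 1 / 2) (hβneg : β < 0)
    (hphi : phi = max (p / (p - 1)) q)
    (hlam : (1 / phi) * (1 - lam / 2) = -β / 2) (hK : 0 ≤ K)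
    (b : ℂ → ℂ) (hb : LocallyIntegrable b volume)
    (hbound : ∀ f : ℂ → ℂ,
      eLpNorm (cauchyComm b f) (ENNReal.ofReal q) volume ≤
        ENNReal.ofReal K * eLpNorm f (ENNReal.ofReal p) volume) :
    ∃ M : ℝ≥0∞, M ≠ ⊤ ∧ ∀ (c : ℂ) (ℓ : ℝ), 0 < ℓ →
      (volume (square c ℓ) ^ (-lam / 2 : ℝ) *
          ∫⁻ z in square c ℓ, ENNReal.ofReal ‖b z - sqAvg b (square c ℓ)‖ ^ phi) ^
        (1 / phi) ≤ M := by

  have hq0 : 0 < q := by linarith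
  have hp0 : 0 < p := by linarith
  refine ⟨ENNReal.ofReal (4 * K), ENNReal.ofReal_ne_top, fun c ℓ hℓ => ?_⟩
  set Q := square c ℓ
  have hQ : MeasurableSet Q := measurableSet_square c ℓ
  have hV : volume Q = ENNReal.ofReal (ℓ ^ 2) := volume_square c hℓ
  have hV0 : volume Q ≠ 0 := by rw [hV]; simp [hℓ.ne']
  have hVt : volume Q ≠ ⊤ := by rw [hV]; exact ENNReal.ofReal_ne_top
  have hVr : ((volume Q).toReal : ℂ) ≠ 0 := by
    exact_mod_cast (ENNReal.toReal_pos hV0 hVt).ne'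
  have hVe : ‖((volume Q).toReal : ℂ)‖ₑ = volume Q := by
    rw [← ofReal_norm, Complex.norm_real, Real.norm_of_nonneg toReal_nonneg,
      ENNReal.ofReal_toReal hVt]
  have hbQ : IntegrableOn b Q volume := integrableOn_square hb c ℓ
  have havg : ((volume Q).toReal : ℂ) * sqAvg b Q = ∫ z in Q, b z := by
    rw [sqAvg, Complex.real_smul, Complex.ofReal_inv, mul_inv_cancel_left₀ hVr]
  simp_rw [ofReal_norm]
  have hosc := fun (g : ℂ → ℂ) hg B hB hgQ =>
    eLpNorm_const_sub_mul_le (p := p) (q := q) (K := K) (g := g) (B := B) (c := c) (ℓ := ℓ)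
      (by linarith) hK hb hbound hg hB hℓ hgQ
  rcases le_total (p / (p - 1)) q with hle | hle
  · rw [max_eq_right hle] at hphi
    subst hphi
    have h1 := hosc (Q.indicator 1) (stronglyMeasurable_one.indicator hQ).aestronglyMeasurable 1
      (fun z => by by_cases hz : z ∈ Q <;> simp [hz]) (fun z hz => Set.indicator_of_notMem hz _)
    have hg : eLpNorm (Q.indicator (1 : ℂ → ℂ)) (ENNReal.ofReal p) volume =
        volume Q ^ (1 / p) := by
      have := eLpNorm_indicator_const (μ := volume) (c := (1 : ℂ)) hQ
        (p := ENNReal.ofReal p) (by simpa using hp0) ENNReal.ofReal_ne_top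
      simpa [ENNReal.toReal_ofReal hp0.le, Pi.one_def] using this
    have hint : ∫ w, Q.indicator (1 : ℂ → ℂ) w = ((volume Q).toReal : ℂ) := by
      simp [integral_indicator hQ, Measure.real]
    have hbint : ∫ w, b w * Q.indicator (1 : ℂ → ℂ) w = ((volume Q).toReal : ℂ) * sqAvg b Q := by
      rw [havg, ← integral_indicator hQ]
      congr 1 with w
      by_cases hw : w ∈ Q <;> simp [hw]
    have hF : (fun z => (∫ w, b w * Q.indicator (1 : ℂ → ℂ) w) -
        b z * ∫ w, Q.indicator (1 : ℂ → ℂ) w) =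
        (-((volume Q).toReal : ℂ)) • fun z => b z - sqAvg b Q := by
      ext z
      rw [hint, hbint]
      simp only [Pi.smul_apply, smul_eq_mul]
      ring
    rw [hF, hg, eLpNorm_const_smul, enorm_neg, hVe, eLpNorm_eq_lintegral_rpow_enorm_toReal
      (by simpa using hq0) ENNReal.ofReal_ne_top, ENNReal.toReal_ofReal hq0.le] at h1
    refine rpow_mul_rpow_le_of_le hq0 hK hℓ hV (γ := 1 / p - 1) ?_ (by simpa using h1)
    rw [mul_sub, mul_one] at hlam
    have : lam / phi = 2 * (1 / phi * (lam / 2)) := by ring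
    linarith
  · rw [max_eq_left hle] at hphi
    have hpp : p.HolderConjugate phi := hphi ▸ Real.HolderConjugate.conjExponent hp
    have hphi2 : 2 < phi := by
      rw [hphi, lt_div_iff₀ (by linarith)]
      linarith
    refine rpow_mul_rpow_le_of_le (by linarith) hK hℓ hV (γ := -1 / q) ?_ ?_
    · have hconj := hpp.inv_add_inv_eq_one
      rw [← one_div, ← one_div] at hconj
      rw [mul_sub, mul_one] at hlam
      have : lam / phi = 2 * (1 / phi * (lam / 2)) := by ring
      have : -1 / q = -(1 / q) := by ring
      linarith
    · have hh : AEStronglyMeasurable (fun z => b z - sqAvg b Q) volume :=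
        hb.aestronglyMeasurable.sub aestronglyMeasurable_const
      rw [mul_comm, ← ENNReal.le_div_iff_mul_le (Or.inl hV0) (Or.inl hVt)]
      refine lintegral_rpow_le_of_forall_integral_mul_le hpp hphi2 hh hQ hVt
        fun g B hg hB hgQ => ?_
      have hbg := integrable_of_bounded_of_square hg hB hgQ hbQ
      have hgi : Integrable g volume := by
        have h1 : IntegrableOn (fun _ : ℂ => (1 : ℂ)) Q volume := by
          simp [integrableOn_const_iff, hVt.lt_top]
        simpa using integrable_of_bounded_of_square hg hB hgQ h1
      set F : ℂ → ℂ := fun z => (∫ w, b w * g w) - b z * ∫ w, g w with hF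
      have hFm : AEStronglyMeasurable F (volume.restrict Q) :=
        aestronglyMeasurable_const.sub (hb.aestronglyMeasurable.restrict.mul_const _)
      have hFint : ((volume Q).toReal : ℂ) * ∫ z, (b z - sqAvg b Q) * g z = ∫ z in Q, F z := by
        have hci : Integrable (fun _ => ∫ w, b w * g w) (volume.restrict Q) :=
          integrableOn_const hVt
        simp_rw [hF, sub_mul]
        rw [integral_sub hbg (hgi.const_mul _),
          integral_sub hci (hbQ.mul_const _), integral_const_mul,
          integral_mul_const, ← havg, setIntegral_const, Complex.real_smul, Measure.real]
        ring
      have hHolder := eLpNorm_le_eLpNorm_mul_rpow_measure_univ (p := 1) (q := ENNReal.ofReal q)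
        (by simpa using (by linarith : 1 ≤ q)) hFm
      rw [Measure.restrict_apply_univ, ENNReal.toReal_ofReal hq0.le, ENNReal.toReal_one,
        div_one, eLpNorm_one_eq_lintegral_enorm] at hHolder
      rw [← ENNReal.mul_div_right_comm, ENNReal.le_div_iff_mul_le (Or.inl hV0) (Or.inl hVt)]
      calc _ = ‖∫ z in Q, F z‖ₑ := by rw [← hFint, enorm_mul, hVe, mul_comm]
        _ ≤ _ := (enorm_integral_le_lintegral_enorm _).trans hHolder
        _ ≤ _ := mul_le_mul_left (hosc g hg B hB hgQ) _
        _ = _ := by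
          rw [mul_right_comm, show (1 : ℝ) - 1 / q = 1 + -1 / q by ring]
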